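/- For every n ≥ 2, the number of quasi-Stirling permutations of the multiset [n,n] that avoid all of the patterns 123, 132, 213, and 231 equals 4. -/

import Mathlib

/-- `π : Fin (2*n) → Fin n` encodes a permutation of the multiset
`{1,1,2,2,…,n,n}`: every value appears exactly twice. -/
def IsMultisetPerm (n : ℕ) (π : Fin (2 * n) → Fin n) : Prop :=
  ∀ v : Fin n, Nat.card {i : Fin (2 * n) // π i = v} = 2

/-- `π` avoids the pattern 1212. -/
def Avoids1212 (n : ℕ) (π : Fin (2 * n) → Fin n) : Prop :=
  ¬ ∃ i j k l : Fin (2 * n), i < j ∧ j < k ∧ k < l ∧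
      π i = π k ∧ π j = π l ∧ π i < π j

/-- `π` avoids the pattern 2121. -/
def Avoids2121 (n : ℕ) (π : Fin (2 * n) → Fin n) : Prop :=
  ¬ ∃ i j k l : Fin (2 * n), i < j ∧ j < k ∧ k < l ∧
      π i = π k ∧ π j = π l ∧ π j < π i

/-- A quasi-Stirling permutation: a permutation of the multiset `[n,n]`
avoiding both 1212 and 2121. -/
def IsQuasiStirling (n : ℕ) (π : Fin (2 * n) → Fin n) : Prop :=
  IsMultisetPerm n π ∧ Avoids1212 n π ∧ Avoids2121 n π

/-- `π` contains the length-3 pattern `σ` (with distinct entries):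
there are positions `i₁ < i₂ < i₃` whose values are in the same relative
order as `σ`. -/
def Contains3 (n : ℕ) (σ : Fin 3 → ℕ) (π : Fin (2 * n) → Fin n) : Prop :=
  ∃ f : Fin 3 → Fin (2 * n), StrictMono f ∧
    ∀ a b : Fin 3, π (f a) < π (f b) ↔ σ a < σ b

/-- `π` avoids the length-3 pattern `σ`. -/
def Avoids3 (n : ℕ) (σ : Fin 3 → ℕ) (π : Fin (2 * n) → Fin n) : Prop :=
  ¬ Contains3 n σ π

/-- The first entry of any three entries with distinct values is the largest. -/
def FirstIsLargest (n : ℕ) (π : Fin (2 * n) → Fin n) : Prop :=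
  ∀ i j k : Fin (2 * n), i < j → j < k → π i ≠ π j → π i ≠ π k → π j ≠ π k →
    π j < π i ∧ π k < π i

theorem contains3_of_lt {n : ℕ} {π : Fin (2 * n) → Fin n} {i j k : Fin (2 * n)} {σ : Fin 3 → ℕ}
    (hij : i < j) (hjk : j < k) (h01 : π i < π j ↔ σ 0 < σ 1) (h10 : π j < π i ↔ σ 1 < σ 0)
    (h02 : π i < π k ↔ σ 0 < σ 2) (h20 : π k < π i ↔ σ 2 < σ 0)
    (h12 : π j < π k ↔ σ 1 < σ 2) (h21 : π k < π j ↔ σ 2 < σ 1) : Contains3 n σ π := by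
  refine ⟨![i, j, k], ?_, ?_⟩
  · intro a b hab
    fin_cases a <;> fin_cases b <;> simp_all
    omega
  · intro a b
    fin_cases a <;> fin_cases b <;> simp_all

theorem avoids3_iff_firstIsLargest {n : ℕ} {π : Fin (2 * n) → Fin n} :
    (Avoids3 n ![1, 2, 3] π ∧ Avoids3 n ![1, 3, 2] π ∧ Avoids3 n ![2, 1, 3] π ∧
      Avoids3 n ![2, 3, 1] π) ↔ FirstIsLargest n π := by
  constructor
  · rintro ⟨h₁, h₂, h₃, h₄⟩ i j k hij hjk hπij hπik hπjk
    by_contra hc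
    have hcases : (π i < π j ∧ π j < π k) ∨ (π i < π k ∧ π k < π j) ∨
        (π j < π i ∧ π i < π k) ∨ (π k < π i ∧ π i < π j) := by omega
    rcases hcases with h | h | h | h
    · exact h₁ (contains3_of_lt hij hjk (by simp; omega) (by simp; omega) (by simp; omega)
        (by simp; omega) (by simp; omega) (by simp; omega))
    · exact h₂ (contains3_of_lt hij hjk (by simp; omega) (by simp; omega) (by simp; omega)
        (by simp; omega) (by simp; omega) (by simp; omega))
    · exact h₃ (contains3_of_lt hij hjk (by simp; omega) (by simp; omega) (by simp; omega)
        (by simp; omega) (by simp; omega) (by simp; omega))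
    · exact h₄ (contains3_of_lt hij hjk (by simp; omega) (by simp; omega) (by simp; omega)
        (by simp; omega) (by simp; omega) (by simp; omega))
  · intro h
    refine ⟨?_, ?_, ?_, ?_⟩ <;>
    · rintro ⟨f, hf, hfσ⟩
      have h01 := hfσ 0 1
      have h10 := hfσ 1 0
      have h02 := hfσ 0 2
      have h20 := hfσ 2 0
      have h12 := hfσ 1 2
      have h21 := hfσ 2 1
      simp at h01 h10 h02 h20 h12 h21
      have := h (f 0) (f 1) (f 2) (hf (by decide)) (hf (by decide))
        (by omega) (by omega) (by omega)
      omega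

theorem isMultisetPerm_iff {n : ℕ} {π : Fin (2 * n) → Fin n} :
    IsMultisetPerm n π ↔ ∀ v, (Finset.univ.filter fun i => π i = v).card = 2 := by
  simp [IsMultisetPerm, Nat.card_eq_fintype_card, Fintype.card_subtype]

/-- The only ascents, adjacent or not, go from the least to the second least value. -/
theorem FirstIsLargest.eq_zero_one_of_lt {n : ℕ} {π : Fin (2 * n) → Fin n}
    (h : FirstIsLargest n π) (hπ : IsMultisetPerm n π) {i j : Fin (2 * n)} (hij : i < j)
    (hlt : π i < π j) : (π i : ℕ) = 0 ∧ (π j : ℕ) = 1 := by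
  have key : ∀ c : Fin n, c ≠ π i → c ≠ π j → π j < c := by
    intro c hci hcj
    have hne : (Finset.univ.filter fun k => π k = c).Nonempty := by
      rw [← Finset.card_pos, isMultisetPerm_iff.1 hπ c]
      norm_num
    obtain ⟨k, hk⟩ := hne
    simp only [Finset.mem_filter, Finset.mem_univ, true_and] at hk
    subst hk
    have hki : k ≠ i := by rintro rfl; exact hci rfl
    have hkj : k ≠ j := by rintro rfl; exact hcj rfl
    rcases lt_or_ge k i with hk | hk
    · exact (h k i j hk hij hci hcj (by omega)).2
    · rcases lt_or_ge k j with hk' | hk'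
      · have := h i k j (by omega) hk' (by omega) (by omega) (by omega)
        omega
      · have := h i j k hij (by omega) (by omega) (by omega) (by omega)
        omega
  have hi := (π i).isLt
  have hj := (π j).isLt
  have h0 := key ⟨0, by omega⟩
  have h1 := key ⟨1, by omega⟩
  simp only [ne_eq, Fin.ext_iff, Fin.lt_def] at h0 h1 hlt
  omega

theorem card_filter_lt {n : ℕ} {π : Fin (2 * n) → Fin n} (hπ : IsMultisetPerm n π) (v : Fin n) :
    (Finset.univ.filter fun i => v < π i).card = 2 * (n - 1 - v) := by
  rw [Finset.card_eq_sum_card_fiberwise (f := π) (t := Finset.Ioi v)]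
  · have : ∀ u ∈ Finset.Ioi v,
        ((Finset.univ.filter fun i => v < π i).filter fun i => π i = u).card = 2 := by
      intro u hu
      rw [Finset.filter_filter]
      refine Eq.trans (congrArg Finset.card ?_) (isMultisetPerm_iff.1 hπ u)
      ext i
      simp only [Finset.mem_filter, Finset.mem_univ, true_and, Finset.mem_Ioi] at hu ⊢
      constructor
      · exact fun h => h.2
      · rintro rfl
        exact ⟨hu, rfl⟩
    rw [Finset.sum_congr rfl this, Finset.sum_const, Fin.card_Ioi, smul_eq_mul, mul_comm]
  · intro i hi
    simpa using hi

theorem FirstIsLargest.lt_apply_iff {n : ℕ} {π : Fin (2 * n) → Fin n} (h : FirstIsLargest n π)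
    (hπ : IsMultisetPerm n π) {v : Fin n} (hv : 1 ≤ (v : ℕ)) (i : Fin (2 * n)) :
    v < π i ↔ (i : ℕ) < 2 * (n - 1 - v) := by
  rw [← card_filter_lt hπ v]
  have hlower : ∀ j k : Fin (2 * n), j ≤ k → v < π k → v < π j := by
    intro j k hjk hk
    rcases hjk.eq_or_lt with rfl | hjk
    · exact hk
    · by_contra hc
      have := h.eq_zero_one_of_lt hπ hjk (by omega)
      omega
  constructor
  · intro hi
    have hsub : Finset.Iic i ⊆ Finset.univ.filter fun i => v < π i := by
      intro j hj
      simpa using hlower j i (by simpa using hj) hi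
    have := Finset.card_le_card hsub
    rw [Fin.card_Iic] at this
    omega
  · intro hi
    by_contra hc
    have hsub : (Finset.univ.filter fun i => v < π i) ⊆ Finset.Iio i := by
      intro j hj
      simp only [Finset.mem_filter, Finset.mem_univ, true_and, Finset.mem_Iio] at hj ⊢
      by_contra hij
      exact hc (hlower i j (by omega) hj)
    have := Finset.card_le_card hsub
    rw [Fin.card_Iio] at this
    omega

/-- The word `n n … 3 3` (with values shifted down by one) followed by `a, b, 1 - a, 1 - b`. -/
def descendingWord (m : ℕ) (p : Bool × Bool) (i : Fin (2 * (m + 2))) : Fin (m + 2) :=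
  if (i : ℕ) < 2 * m then ⟨m + 1 - i / 2, by omega⟩
  else if (i : ℕ) = 2 * m then ⟨p.1.toNat, by have := p.1.toNat_le; omega⟩
  else if (i : ℕ) = 2 * m + 1 then ⟨p.2.toNat, by have := p.2.toNat_le; omega⟩
  else if (i : ℕ) = 2 * m + 2 then ⟨1 - p.1.toNat, by omega⟩
  else ⟨1 - p.2.toNat, by omega⟩

theorem descendingWord_val (m : ℕ) (p : Bool × Bool) (i : Fin (2 * (m + 2))) :
    (descendingWord m p i : ℕ) = if (i : ℕ) < 2 * m then m + 1 - i / 2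
      else if (i : ℕ) = 2 * m then p.1.toNat
      else if (i : ℕ) = 2 * m + 1 then p.2.toNat
      else if (i : ℕ) = 2 * m + 2 then 1 - p.1.toNat
      else 1 - p.2.toNat := by
  unfold descendingWord
  split_ifs <;> rfl

theorem isMultisetPerm_descendingWord (m : ℕ) (p : Bool × Bool) :
    IsMultisetPerm (m + 2) (descendingWord m p) := by
  rw [isMultisetPerm_iff]
  intro v
  have hv := v.isLt
  have of_pair : ∀ x y : Fin (2 * (m + 2)), x ≠ y →
      (∀ i, descendingWord m p i = v ↔ i = x ∨ i = y) →
      (Finset.univ.filter fun i => descendingWord m p i = v).card = 2 := by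
    intro x y hxy hi
    rw [Finset.card_eq_two]
    exact ⟨x, y, hxy, by ext i; simp [hi]⟩
  by_cases h2 : 2 ≤ (v : ℕ)
  · refine of_pair ⟨2 * (m + 1 - v), by omega⟩ ⟨2 * (m + 1 - v) + 1, by omega⟩
      (by simp) fun i => ?_
    have hp := p.1.toNat_le
    have hq := p.2.toNat_le
    simp only [Fin.ext_iff, descendingWord_val]
    split_ifs <;> omega
  · obtain ⟨a, b⟩ := p
    refine of_pair ⟨if a.toNat = v then 2 * m else 2 * m + 2, by split_ifs <;> omega⟩
      ⟨if b.toNat = v then 2 * m + 1 else 2 * m + 3, by split_ifs <;> omega⟩ ?_ fun i => ?_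
    · simp only [ne_eq, Fin.ext_iff]
      split_ifs <;> omega
    · have hp := a.toNat_le
      have hq := b.toNat_le
      have hi := i.isLt
      simp only [Fin.ext_iff, descendingWord_val]
      split_ifs <;> omega

theorem descendingWord_ne_of_crossing (m : ℕ) (p : Bool × Bool) {i j k l : Fin (2 * (m + 2))}
    (hij : i < j) (hjk : j < k) (hkl : k < l) : descendingWord m p i ≠ descendingWord m p k := by
  have hp := p.1.toNat_le
  have hq := p.2.toNat_le
  have hl := l.isLt
  rw [ne_eq, Fin.ext_iff, descendingWord_val, descendingWord_val]
  split_ifs <;> omega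

theorem isQuasiStirling_descendingWord (m : ℕ) (p : Bool × Bool) :
    IsQuasiStirling (m + 2) (descendingWord m p) := by
  refine ⟨isMultisetPerm_descendingWord m p, ?_, ?_⟩ <;>
  · rintro ⟨i, j, k, l, hij, hjk, hkl, hik, -, -⟩
    exact descendingWord_ne_of_crossing m p hij hjk hkl hik

theorem firstIsLargest_descendingWord (m : ℕ) (p : Bool × Bool) :
    FirstIsLargest (m + 2) (descendingWord m p) := by
  have key : ∀ i j : Fin (2 * (m + 2)), i < j →
      (descendingWord m p j : ℕ) ≤ descendingWord m p i ∨
        (2 * m ≤ (i : ℕ) ∧ (descendingWord m p i : ℕ) ≤ 1) := by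
    intro i j hij
    have hp := p.1.toNat_le
    have hq := p.2.toNat_le
    rw [descendingWord_val, descendingWord_val]
    split_ifs <;> omega
  have tail : ∀ i : Fin (2 * (m + 2)), 2 * m ≤ (i : ℕ) → (descendingWord m p i : ℕ) ≤ 1 := by
    intro i hi
    have hp := p.1.toNat_le
    have hq := p.2.toNat_le
    rw [descendingWord_val]
    split_ifs <;> omega
  intro i j k hij hjk hπij hπik hπjk
  have hj := key i j hij
  have hk := key i k (hij.trans hjk)
  have ti := tail i
  have tj := tail j
  have tk := tail k
  simp only [ne_eq, Fin.ext_iff, Fin.lt_def] at *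
  omega

theorem descendingWord_injective (m : ℕ) : Function.Injective (descendingWord m) := by
  rintro ⟨a, b⟩ ⟨c, d⟩ h
  have h0 := congrArg Fin.val (congrFun h ⟨2 * m, by omega⟩)
  have h1 := congrArg Fin.val (congrFun h ⟨2 * m + 1, by omega⟩)
  rw [descendingWord_val, descendingWord_val] at h0 h1
  simp at h0 h1
  clear h
  revert h0 h1
  revert a b c d
  decide

theorem exists_descendingWord_eq {m : ℕ} {π : Fin (2 * (m + 2)) → Fin (m + 2)}
    (hπ : IsQuasiStirling (m + 2) π) (h : FirstIsLargest (m + 2) π) :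
    ∃ p, descendingWord m p = π := by
  obtain ⟨hperm, h1212, h2121⟩ := hπ
  have head : ∀ i : Fin (2 * (m + 2)), (i : ℕ) < 2 * m → (π i : ℕ) = m + 1 - i / 2 := by
    intro i hi
    have hlo := (h.lt_apply_iff hperm (v := ⟨m - i / 2, by omega⟩) (by simp; omega) i).2
      (by simp; omega)
    have hhi := (h.lt_apply_iff hperm (v := ⟨m + 1 - i / 2, by omega⟩) (by simp; omega) i).not.2
      (by simp; omega)
    simp only [Fin.lt_def] at hlo hhi
    omega
  have tail : ∀ i : Fin (2 * (m + 2)), 2 * m ≤ (i : ℕ) → (π i : ℕ) ≤ 1 := by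
    intro i hi
    have := (h.lt_apply_iff hperm (v := ⟨1, by omega⟩) le_rfl i).not.2 (by simp; omega)
    simp only [Fin.lt_def] at this
    omega
  have no_three : ∀ i j k : Fin (2 * (m + 2)), i < j → j < k → π i = π j → π j ≠ π k := by
    intro i j k hij hjk h₁ h₂
    have hsub : ({i, j, k} : Finset (Fin (2 * (m + 2)))) ⊆
        Finset.univ.filter fun x => π x = π k := by
      intro x hx
      simp only [Finset.mem_insert, Finset.mem_singleton] at hx
      rcases hx with rfl | rfl | rfl <;> simp [h₁, h₂]
    have := Finset.card_le_card hsub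
    rw [isMultisetPerm_iff.1 hperm, Finset.card_eq_three.2 ⟨i, j, k, hij.ne, (hij.trans hjk).ne,
      hjk.ne, rfl⟩] at this
    omega
  let x₀ : Fin (2 * (m + 2)) := ⟨2 * m, by omega⟩
  let x₁ : Fin (2 * (m + 2)) := ⟨2 * m + 1, by omega⟩
  let x₂ : Fin (2 * (m + 2)) := ⟨2 * m + 2, by omega⟩
  let x₃ : Fin (2 * (m + 2)) := ⟨2 * m + 3, by omega⟩
  have l₀₁ : x₀ < x₁ := by simp [x₀, x₁]
  have l₁₂ : x₁ < x₂ := by simp [x₁, x₂]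
  have l₂₃ : x₂ < x₃ := by simp [x₂, x₃]
  have t₀ := tail x₀ (by simp [x₀])
  have t₁ := tail x₁ (by simp [x₁])
  have t₂ := tail x₂ (by simp [x₂])
  have t₃ := tail x₃ (by simp [x₃])
  have n₀₁₂ := no_three x₀ x₁ x₂ l₀₁ l₁₂
  have n₀₁₃ := no_three x₀ x₁ x₃ l₀₁ (l₁₂.trans l₂₃)
  have n₀₂₃ := no_three x₀ x₂ x₃ (l₀₁.trans l₁₂) l₂₃
  have n₁₂₃ := no_three x₁ x₂ x₃ l₁₂ l₂₃
  have c₁ : ¬ (π x₀ = π x₂ ∧ π x₁ = π x₃ ∧ π x₀ < π x₁) := fun hc =>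
    h1212 ⟨x₀, x₁, x₂, x₃, l₀₁, l₁₂, l₂₃, hc⟩
  have c₂ : ¬ (π x₀ = π x₂ ∧ π x₁ = π x₃ ∧ π x₁ < π x₀) := fun hc =>
    h2121 ⟨x₀, x₁, x₂, x₃, l₀₁, l₁₂, l₂₃, hc⟩
  have to_nat : ∀ k : ℕ, k ≤ 1 → (decide (k = 1)).toNat = k := by
    intro k hk
    interval_cases k <;> rfl
  refine ⟨(decide ((π x₀ : ℕ) = 1), decide ((π x₁ : ℕ) = 1)), ?_⟩
  ext i
  rw [descendingWord_val]
  simp only [to_nat _ t₀, to_nat _ t₁]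
  simp only [ne_eq, Fin.ext_iff, Fin.lt_def] at n₀₁₂ n₀₁₃ n₀₂₃ n₁₂₃ c₁ c₂
  split_ifs with h₀ h₁ h₂ h₃
  · exact (head i h₀).symm
  · rw [show i = x₀ from Fin.ext h₁]
  · rw [show i = x₁ from Fin.ext h₂]
  · rw [show i = x₂ from Fin.ext h₃]
    omega
  · rw [show i = x₃ from Fin.ext (by simp only [x₃]; omega)]
    omega

theorem quasiStirling_avoiding_123_132_213_231 (n : ℕ) (hn : 2 ≤ n) :
    Nat.card {π : Fin (2 * n) → Fin n //
      IsQuasiStirling n π ∧ Avoids3 n ![1, 2, 3] π ∧ Avoids3 n ![1, 3, 2] π ∧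
        Avoids3 n ![2, 1, 3] π ∧ Avoids3 n ![2, 3, 1] π} = 4 := by
  obtain ⟨m, rfl⟩ := Nat.exists_eq_add_of_le' hn
  simp only [avoids3_iff_firstIsLargest]
  let f : Bool × Bool → {π : Fin (2 * (m + 2)) → Fin (m + 2) //
      IsQuasiStirling (m + 2) π ∧ FirstIsLargest (m + 2) π} := fun p =>
    ⟨descendingWord m p, isQuasiStirling_descendingWord m p, firstIsLargest_descendingWord m p⟩
  have hf : Function.Bijective f := by
    constructor
    · intro p q hpq
      exact descendingWord_injective m (congrArg Subtype.val hpq)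
    · rintro ⟨π, hπ, h⟩
      obtain ⟨p, hp⟩ := exists_descendingWord_eq hπ h
      exact ⟨p, Subtype.ext hp⟩
  rw [← Nat.card_eq_of_bijective f hf]
  simp
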